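/- Suppose the high temperature condition holds with parameters q ∈ [0,1) and K > 0, and let v = v(g,σ) be a bounded function of the disorder and the configuration. Then there exists a constant C depending only on β, h, K such that (1/N) Σ_{j=1}^N E ⟨σ̇_j v⟩² ≤ C ( E ⟨v⁴⟩ )^{1/2} / √N. -/

import Mathlib

open MeasureTheory ProbabilityTheory Real Finset

namespace SK

/-- Index set of pairs `i < j` in `Fin N`. -/
abbrev Pairs (N : ℕ) := {p : Fin N × Fin N // p.1 < p.2}

/-- The disorder: one real coordinate per pair. -/
abbrev Disorder (N : ℕ) := Pairs N → ℝ

/-- Law of the disorder: i.i.d. standard Gaussians. -/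
noncomputable def μdis (N : ℕ) : Measure (Disorder N) :=
  Measure.pi fun _ => gaussianReal 0 1

/-- The symmetric extension `g_{ij}` of the disorder. -/
noncomputable def gval {N : ℕ} (G : Disorder N) (i j : Fin N) : ℝ :=
  if hij : i < j then G ⟨(i, j), hij⟩ else if hji : j < i then G ⟨(j, i), hji⟩ else 0

abbrev Config (N : ℕ) := Fin N → Bool

/-- Spins `±1`. -/
def spin (b : Bool) : ℝ := if b then 1 else -1

/-- (Negative) Hamiltonian of the SK model. -/
noncomputable def ham {N : ℕ} (β h : ℝ) (G : Disorder N) (σ : Config N) : ℝ :=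
  (β / Real.sqrt N) * ∑ p : Pairs N, G p * spin (σ p.1.1) * spin (σ p.1.2)
    + h * ∑ i, spin (σ i)

/-- Partition function. -/
noncomputable def Zpart {N : ℕ} (β h : ℝ) (G : Disorder N) : ℝ :=
  ∑ σ : Config N, Real.exp (ham β h G σ)

/-- Gibbs measure. -/
noncomputable def gibbs {N : ℕ} (β h : ℝ) (G : Disorder N) (σ : Config N) : ℝ :=
  Real.exp (ham β h G σ) / Zpart β h G

/-- Quenched average of a function of one replica. -/
noncomputable def qavg {N : ℕ} (β h : ℝ) (G : Disorder N) (f : Config N → ℝ) : ℝ :=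
  ∑ σ : Config N, f σ * gibbs β h G σ

/-- Quenched average of a function of two replicas. -/
noncomputable def qavg2 {N : ℕ} (β h : ℝ) (G : Disorder N)
    (f : Config N → Config N → ℝ) : ℝ :=
  ∑ σ1 : Config N, ∑ σ2 : Config N, f σ1 σ2 * gibbs β h G σ1 * gibbs β h G σ2

/-- Overlap of two configurations. -/
noncomputable def overlap {N : ℕ} (σ1 σ2 : Config N) : ℝ :=
  (1 / (N : ℝ)) * ∑ i, spin (σ1 i) * spin (σ2 i)

/-- The high temperature condition `E⟨(R₁₂ - q)⁴⟩ ≤ K/N²`. -/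
def highTemp (N : ℕ) (β h q K : ℝ) : Prop :=
  ∫ G, qavg2 β h G (fun σ1 σ2 => (overlap σ1 σ2 - q) ^ 4) ∂(μdis N) ≤ K / (N : ℝ) ^ 2

/-- Magnetization `⟨σ_i⟩`. -/
noncomputable def mavg {N : ℕ} (β h : ℝ) (G : Disorder N) (i : Fin N) : ℝ :=
  qavg β h G fun σ => spin (σ i)

/-- Local field `ℓ_i`. -/
noncomputable def locField {N : ℕ} (G : Disorder N) (i : Fin N) (σ : Config N) : ℝ :=
  (1 / Real.sqrt N) * ∑ j ∈ Finset.univ.erase i, gval G i j * spin (σ j)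

/-- The field `r_i`. -/
noncomputable def rfield {N : ℕ} (β h q : ℝ) (G : Disorder N) (i : Fin N) : ℝ :=
  (1 / Real.sqrt N) * ∑ j ∈ Finset.univ.erase i, gval G i j * mavg β h G j
    - β * (1 - q) * mavg β h G i

/-- Gaussian density `φ_{μ,v}` with mean `μ` and variance `v`. -/
noncomputable def gaussDens (μ v x : ℝ) : ℝ :=
  (1 / (Real.sqrt (2 * π) * Real.sqrt v)) * Real.exp (-(x - μ) ^ 2 / (2 * v))

/-- Mixture-Gaussian density `ψ_{a,b,μ,v}`. -/
noncomputable def mixDens (a b μ v x : ℝ) : ℝ :=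
  Real.cosh (a * x + b) * Real.exp (-(x - μ) ^ 2 / (2 * v)) /
    (Real.sqrt (2 * π) * Real.sqrt v * Real.cosh (a * μ + b) * Real.exp (a ^ 2 * v / 2))

lemma sq_weighted_sum_mul_le {ι : Type*} [Fintype ι] {p : ι → ℝ} (hp : ∀ i, 0 ≤ p i)
    (f g : ι → ℝ) :
    (∑ i, f i * g i * p i) ^ 2 ≤ (∑ i, f i ^ 2 * p i) * ∑ i, g i ^ 2 * p i :=
  Finset.sum_sq_le_sum_mul_sum_of_sq_le_mul _
    (fun i _ => mul_nonneg (sq_nonneg _) (hp i)) (fun i _ => mul_nonneg (sq_nonneg _) (hp i))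
    fun i _ => le_of_eq (by ring)

lemma sq_weighted_sum_le {ι : Type*} [Fintype ι] {p : ι → ℝ} (hp : ∀ i, 0 ≤ p i)
    (hp1 : ∑ i, p i = 1) (f : ι → ℝ) :
    (∑ i, f i * p i) ^ 2 ≤ ∑ i, f i ^ 2 * p i := by
  simpa [hp1] using sq_weighted_sum_mul_le hp f 1

lemma sq_integral_mul_le {Ω : Type*} [MeasurableSpace Ω] {μ : Measure Ω} {f g : Ω → ℝ}
    (hf : MemLp f 2 μ) (hg : MemLp g 2 μ) :
    (∫ x, f x * g x ∂μ) ^ 2 ≤ (∫ x, f x ^ 2 ∂μ) * ∫ x, g x ^ 2 ∂μ := by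
  have key : ∀ t : ℝ, 0 ≤ (∫ x, f x ^ 2 ∂μ) * (t * t) + (2 * ∫ x, f x * g x ∂μ) * t
      + ∫ x, g x ^ 2 ∂μ := by
    intro t
    have h0 : 0 ≤ ∫ x, (f x * t + g x) ^ 2 ∂μ := integral_nonneg fun x => sq_nonneg _
    have hfg : Integrable (fun x => f x * g x) μ := hf.integrable_mul hg
    have h1 : ∫ x, (f x * t + g x) ^ 2 ∂μ
        = ∫ x, (f x ^ 2 * (t * t) + f x * g x * (2 * t)) + g x ^ 2 ∂μ := by
      congr 1; ext x; ring
    have hff : Integrable (fun x => f x ^ 2 * (t * t)) μ := hf.integrable_sq.mul_const _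
    have hfg' : Integrable (fun x => f x * g x * (2 * t)) μ := hfg.mul_const _
    have hsum : Integrable (fun x => f x ^ 2 * (t * t) + f x * g x * (2 * t)) μ := hff.add hfg'
    rw [h1, integral_add hsum hg.integrable_sq, integral_add hff hfg', integral_mul_const,
      integral_mul_const] at h0
    linarith
  have := discrim_le_zero key
  unfold discrim at this
  linarith

section Gibbs

variable {N : ℕ} (β h : ℝ)

lemma Zpart_pos (G : Disorder N) : 0 < Zpart β h G :=
  Finset.sum_pos (fun _ _ => Real.exp_pos _) Finset.univ_nonempty

lemma gibbs_nonneg (G : Disorder N) (σ : Config N) : 0 ≤ gibbs β h G σ :=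
  div_nonneg (Real.exp_pos _).le (Zpart_pos β h G).le

lemma sum_gibbs (G : Disorder N) : ∑ σ, gibbs β h G σ = 1 := by
  unfold gibbs
  rw [← Finset.sum_div]
  exact div_self (Zpart_pos β h G).ne'

lemma measurable_gibbs (σ : Config N) : Measurable fun G => gibbs β h G σ := by
  unfold gibbs Zpart ham
  fun_prop

lemma measurable_qavg {f : Disorder N → Config N → ℝ} (hf : ∀ σ, Measurable fun G => f G σ) :
    Measurable fun G => qavg β h G (f G) :=
  Finset.measurable_sum _ fun σ _ => (hf σ).mul (measurable_gibbs β h σ)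

lemma abs_qavg_le (G : Disorder N) {f : Config N → ℝ} {M : ℝ} (hf : ∀ σ, |f σ| ≤ M) :
    |qavg β h G f| ≤ M := by
  calc |qavg β h G f| ≤ ∑ σ, |f σ * gibbs β h G σ| := Finset.abs_sum_le_sum_abs _ _
    _ ≤ ∑ σ, M * gibbs β h G σ := Finset.sum_le_sum fun σ _ => by
        rw [abs_mul, abs_of_nonneg (gibbs_nonneg β h G σ)]
        exact mul_le_mul_of_nonneg_right (hf σ) (gibbs_nonneg β h G σ)
    _ = M := by rw [← Finset.mul_sum, sum_gibbs, mul_one]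

lemma qavg2_eq (G : Disorder N) (f : Config N → Config N → ℝ) :
    qavg2 β h G f = qavg β h G fun σ => qavg β h G (f σ) := by
  unfold qavg2 qavg
  refine Finset.sum_congr rfl fun σ _ => ?_
  rw [Finset.sum_mul]
  exact Finset.sum_congr rfl fun τ _ => by ring

lemma qavg2_eq_sum_prod (G : Disorder N) (f : Config N → Config N → ℝ) :
    qavg2 β h G f
      = ∑ x : Config N × Config N, f x.1 x.2 * (gibbs β h G x.1 * gibbs β h G x.2) := by
  rw [Fintype.sum_prod_type]
  simp only [qavg2, mul_assoc]

lemma measurable_qavg2 (f : Config N → Config N → ℝ) :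
    Measurable fun G : Disorder N => qavg2 β h G f := by
  simp only [qavg2_eq]
  exact measurable_qavg β h fun σ => measurable_qavg β h fun τ => measurable_const

lemma exists_abs_qavg2_le (f : Config N → Config N → ℝ) :
    ∃ M : ℝ, ∀ G : Disorder N, |qavg2 β h G f| ≤ M := by
  obtain ⟨M, hM⟩ := Finite.exists_le fun x : Config N × Config N => |f x.1 x.2|
  refine ⟨M, fun G => ?_⟩
  rw [qavg2_eq]
  exact abs_qavg_le β h G fun σ => abs_qavg_le β h G fun τ => hM (σ, τ)

/-- The covariances of the spins with `v` are tested by the overlap, up to an arbitrary shift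
of the overlap. -/
lemma avg_sq_cov_eq (G : Disorder N) (q : ℝ) (v : Config N → ℝ) :
    (1 / (N : ℝ)) * ∑ j : Fin N, qavg β h G (fun σ => (spin (σ j) - mavg β h G j) * v σ) ^ 2
      = qavg2 β h G fun σ τ => (overlap σ τ - q)
          * ((v σ - qavg β h G v) * (v τ - qavg β h G v)) := by
  set m := qavg β h G v with hm
  set p := gibbs β h G with hp
  have hcent : ∑ σ, (v σ - m) * p σ = 0 := by
    simp only [sub_mul, Finset.sum_sub_distrib, ← Finset.mul_sum]
    rw [hp, sum_gibbs, hm, qavg]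
    ring
  have hcov : ∀ j, qavg β h G (fun σ => (spin (σ j) - mavg β h G j) * v σ)
      = ∑ σ, spin (σ j) * (v σ - m) * p σ := by
    intro j
    have h1 : qavg β h G (fun σ => (spin (σ j) - mavg β h G j) * v σ)
        = ∑ σ, spin (σ j) * v σ * p σ - mavg β h G j * m := by
      simp only [qavg, sub_mul, Finset.sum_sub_distrib, hm, Finset.mul_sum, hp, mul_assoc]
    have h2 : ∑ σ, spin (σ j) * (v σ - m) * p σ
        = ∑ σ, spin (σ j) * v σ * p σ - m * mavg β h G j := by
      rw [mavg, qavg, Finset.mul_sum, ← Finset.sum_sub_distrib]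
      exact Finset.sum_congr rfl fun σ _ => by ring
    rw [h1, h2]
    ring
  have hq : qavg2 β h G (fun σ τ => q * ((v σ - m) * (v τ - m))) = 0 := by
    have : qavg2 β h G (fun σ τ => q * ((v σ - m) * (v τ - m)))
        = q * ((∑ σ, (v σ - m) * p σ) * ∑ σ, (v σ - m) * p σ) := by
      rw [Finset.sum_mul_sum]
      simp only [qavg2, Finset.mul_sum]
      exact Finset.sum_congr rfl fun σ _ => Finset.sum_congr rfl fun τ _ => by ring
    rw [this, hcent]
    ring
  have hsplit : qavg2 β h G (fun σ τ => (overlap σ τ - q) * ((v σ - m) * (v τ - m)))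
      = qavg2 β h G (fun σ τ => overlap σ τ * ((v σ - m) * (v τ - m)))
        - qavg2 β h G (fun σ τ => q * ((v σ - m) * (v τ - m))) := by
    simp only [qavg2, sub_mul, Finset.sum_sub_distrib]
  rw [hsplit, hq, sub_zero]
  simp only [hcov, sq, Finset.sum_mul_sum, qavg2, overlap]
  rw [Finset.sum_comm, Finset.mul_sum]
  refine Finset.sum_congr rfl fun σ _ => ?_
  rw [Finset.sum_comm, Finset.mul_sum]
  refine Finset.sum_congr rfl fun τ _ => ?_
  simp only [Finset.mul_sum, Finset.sum_mul]
  exact Finset.sum_congr rfl fun j _ => by ring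

lemma sq_avg_sq_cov_le (G : Disorder N) (q : ℝ) (v : Config N → ℝ) :
    ((1 / (N : ℝ)) * ∑ j : Fin N,
        qavg β h G (fun σ => (spin (σ j) - mavg β h G j) * v σ) ^ 2) ^ 2
      ≤ √(qavg2 β h G fun σ τ => (overlap σ τ - q) ^ 4) * qavg β h G fun σ => v σ ^ 4 := by
  rw [avg_sq_cov_eq β h G q v]
  set m := qavg β h G v with hm
  have hp := gibbs_nonneg β h G
  have hp1 := sum_gibbs β h G
  have hpp : ∀ x : Config N × Config N, 0 ≤ gibbs β h G x.1 * gibbs β h G x.2 :=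
    fun x => mul_nonneg (hp _) (hp _)
  have hpp1 : ∑ x : Config N × Config N, gibbs β h G x.1 * gibbs β h G x.2 = 1 := by
    rw [Fintype.sum_prod_type, ← Finset.sum_mul_sum, hp1, one_mul]
  have hvar : qavg β h G (fun σ => (v σ - m) ^ 2) ≤ qavg β h G fun σ => v σ ^ 2 := by
    have : qavg β h G (fun σ => (v σ - m) ^ 2) = qavg β h G (fun σ => v σ ^ 2) - m ^ 2 := by
      have h1 : qavg β h G (fun σ => (v σ - m) ^ 2) = qavg β h G (fun σ => v σ ^ 2)
          - 2 * m * qavg β h G v + m ^ 2 * ∑ σ, gibbs β h G σ := by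
        simp only [qavg, Finset.mul_sum, ← Finset.sum_sub_distrib, ← Finset.sum_add_distrib]
        exact Finset.sum_congr rfl fun σ _ => by ring
      rw [h1, hp1, ← hm]
      ring
    rw [this]
    linarith [sq_nonneg m]
  have hprod : ∑ x : Config N × Config N, ((v x.1 - m) * (v x.2 - m)) ^ 2
        * (gibbs β h G x.1 * gibbs β h G x.2) = qavg β h G (fun σ => (v σ - m) ^ 2) ^ 2 := by
    rw [Fintype.sum_prod_type, sq (qavg _ _ _ _), qavg, Finset.sum_mul_sum]
    exact Finset.sum_congr rfl fun σ _ => Finset.sum_congr rfl fun τ _ => by ring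
  have hfour : qavg β h G (fun σ => (v σ - m) ^ 2) ^ 2 ≤ qavg β h G fun σ => v σ ^ 4 := by
    have h0 : 0 ≤ qavg β h G (fun σ => (v σ - m) ^ 2) :=
      Finset.sum_nonneg fun σ _ => mul_nonneg (sq_nonneg _) (hp σ)
    calc _ ≤ qavg β h G (fun σ => v σ ^ 2) ^ 2 := pow_le_pow_left₀ h0 hvar 2
      _ ≤ ∑ σ, (v σ ^ 2) ^ 2 * gibbs β h G σ := sq_weighted_sum_le hp hp1 _
      _ = _ := by simp only [← pow_mul]; rfl
  have hov : ∑ x : Config N × Config N, (overlap x.1 x.2 - q) ^ 2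
        * (gibbs β h G x.1 * gibbs β h G x.2)
      ≤ √(qavg2 β h G fun σ τ => (overlap σ τ - q) ^ 4) := by
    refine Real.le_sqrt_of_sq_le ?_
    refine (sq_weighted_sum_le hpp hpp1 _).trans_eq ?_
    rw [qavg2_eq_sum_prod]
    simp only [← pow_mul]
  rw [qavg2_eq_sum_prod]
  refine (sq_weighted_sum_mul_le hpp (fun x => overlap x.1 x.2 - q)
    fun x => (v x.1 - m) * (v x.2 - m)).trans ?_
  rw [hprod]
  exact mul_le_mul hov hfour (sq_nonneg _) (Real.sqrt_nonneg _)

end Gibbs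

instance isProbabilityMeasure_μdis (N : ℕ) : IsProbabilityMeasure (μdis N) := by
  unfold μdis
  infer_instance

/-- Estimate (3.8). -/
theorem est_sdot_sq (β h K : ℝ) (hβ : 0 < β) (hK : 0 < K) :
    ∃ C : ℝ, 0 < C ∧ ∀ (N : ℕ) (q : ℝ), 2 ≤ N → 0 ≤ q → q < 1 →
      highTemp N β h q K →
      ∀ v : Disorder N → Config N → ℝ,
      (∀ σ, Measurable fun G => v G σ) →
      (∃ M : ℝ, ∀ G σ, |v G σ| ≤ M) →
        (1 / (N : ℝ)) * ∑ j : Fin N,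
            ∫ G, qavg β h G (fun σ => (spin (σ j) - mavg β h G j) * v G σ) ^ 2
              ∂(μdis N)
        ≤ C * Real.sqrt (∫ G, qavg β h G (fun σ => v G σ ^ 4) ∂(μdis N))
            / Real.sqrt N := by
  refine ⟨√√K, by positivity, ?_⟩
  rintro N q hN - - hT v hv ⟨M, hM⟩
  have hN0 : (0 : ℝ) < N := by exact_mod_cast (by omega : 0 < N)
  have hm : ∀ j : Fin N, Measurable fun G => mavg β h G j := fun j =>
    measurable_qavg β h fun σ => measurable_const
  have hcov : ∀ j : Fin N, Measurable fun G =>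
      qavg β h G (fun σ => (spin (σ j) - mavg β h G j) * v G σ) := fun j =>
    measurable_qavg β h fun σ => (measurable_const.sub (hm j)).mul (hv σ)
  have hspin : ∀ b, |spin b| ≤ 1 := by
    intro b
    cases b <;> simp [spin]
  have hcovb : ∀ (j : Fin N) (G : Disorder N),
      |qavg β h G (fun σ => (spin (σ j) - mavg β h G j) * v G σ)| ≤ 2 * M := by
    intro j G
    refine abs_qavg_le β h G fun σ => ?_
    rw [abs_mul]
    refine mul_le_mul ?_ (hM G σ) (abs_nonneg _) zero_le_two
    have h1 := hspin (σ j)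
    have h2 : |mavg β h G j| ≤ 1 := abs_qavg_le β h G fun σ => hspin _
    linarith [abs_sub (spin (σ j)) (mavg β h G j)]
  have hcovi : ∀ j : Fin N, Integrable (fun G =>
      qavg β h G (fun σ => (spin (σ j) - mavg β h G j) * v G σ) ^ 2) (μdis N) := fun j =>
    (MemLp.of_bound (hcov j).aestronglyMeasurable (2 * M)
      (ae_of_all _ fun G => hcovb j G)).integrable_sq
  set A : Disorder N → ℝ := fun G => qavg2 β h G fun σ τ => (overlap σ τ - q) ^ 4 with hA
  set B : Disorder N → ℝ := fun G => qavg β h G fun σ => v G σ ^ 4 with hB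
  have hA0 : ∀ G, 0 ≤ A G := fun G =>
    Finset.sum_nonneg fun σ _ => Finset.sum_nonneg fun τ _ =>
      mul_nonneg (mul_nonneg (by positivity) (gibbs_nonneg β h G _)) (gibbs_nonneg β h G _)
  have hB0 : ∀ G, 0 ≤ B G := fun G =>
    Finset.sum_nonneg fun σ _ => mul_nonneg (by positivity) (gibbs_nonneg β h G _)
  have hAm : Measurable A := measurable_qavg2 β h _
  have hBm : Measurable B := measurable_qavg β h fun σ => (hv σ).pow_const 4
  obtain ⟨MA, hMA⟩ := exists_abs_qavg2_le (N := N) β h fun σ τ => (overlap σ τ - q) ^ 4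
  have hMB : ∀ G, |B G| ≤ M ^ 4 := fun G => abs_qavg_le β h G fun σ => by
    rw [abs_pow]
    exact pow_le_pow_left₀ (abs_nonneg _) (hM G σ) 4
  have hA2 : MemLp (fun G => √(A G)) 2 (μdis N) :=
    MemLp.of_bound hAm.sqrt.aestronglyMeasurable (√MA) (ae_of_all _ fun G => by
      rw [Real.norm_of_nonneg (Real.sqrt_nonneg _)]
      exact Real.sqrt_le_sqrt ((le_abs_self _).trans (hMA G)))
  have hA4 : MemLp (fun G => √√(A G)) 2 (μdis N) :=
    MemLp.of_bound hAm.sqrt.sqrt.aestronglyMeasurable (√√MA) (ae_of_all _ fun G => by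
      rw [Real.norm_of_nonneg (Real.sqrt_nonneg _)]
      exact Real.sqrt_le_sqrt (Real.sqrt_le_sqrt ((le_abs_self _).trans (hMA G))))
  have hB2 : MemLp (fun G => √(B G)) 2 (μdis N) :=
    MemLp.of_bound hBm.sqrt.aestronglyMeasurable (√(M ^ 4)) (ae_of_all _ fun G => by
      rw [Real.norm_of_nonneg (Real.sqrt_nonneg _)]
      exact Real.sqrt_le_sqrt ((le_abs_self _).trans (hMB G)))
  have hfirst : ∫ G, √(A G) ∂(μdis N) ≤ √K / N := by
    have h1 := sq_integral_mul_le hA2 (memLp_const (1 : ℝ))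
    simp only [Real.sq_sqrt (hA0 _), mul_one, one_pow, integral_const, probReal_univ,
      smul_eq_mul] at h1
    have h2 : (∫ G, √(A G) ∂(μdis N)) ^ 2 ≤ K / (N : ℝ) ^ 2 := h1.trans hT
    calc _ ≤ √(K / (N : ℝ) ^ 2) := Real.le_sqrt_of_sq_le h2
      _ = √K / N := by rw [Real.sqrt_div hK.le, Real.sqrt_sq hN0.le]
  rw [← integral_finsetSum _ fun j _ => hcovi j, ← integral_const_mul]
  calc _ ≤ ∫ G, √√(A G) * √(B G) ∂(μdis N) := by
        refine integral_mono ((integrable_finsetSum _ fun j _ => hcovi j).const_mul _)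
          (hA4.integrable_mul hB2) fun G => ?_
        simp only
        rw [← Real.sqrt_mul (Real.sqrt_nonneg _)]
        exact Real.le_sqrt_of_sq_le (sq_avg_sq_cov_le β h G q (v G))
    _ ≤ √((∫ G, √(A G) ∂(μdis N)) * ∫ G, B G ∂(μdis N)) := by
        refine Real.le_sqrt_of_sq_le ?_
        simpa only [Real.sq_sqrt (hB0 _), Real.sq_sqrt (Real.sqrt_nonneg _)]
          using sq_integral_mul_le hA4 hB2
    _ ≤ √(√K / N * ∫ G, B G ∂(μdis N)) :=
        Real.sqrt_le_sqrt (mul_le_mul_of_nonneg_right hfirst (integral_nonneg hB0))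
    _ = √√K * √(∫ G, B G ∂(μdis N)) / √N := by
        rw [Real.sqrt_mul (by positivity), Real.sqrt_div (Real.sqrt_nonneg _)]
        ring

end SK
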